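/- arXiv:2004.13998 — 4 statements merged into one kernel-verified Lean document; each statement's English description precedes it below -/
import Mathlib

section
/- Let α₀ ≠ 0 be real, β₁ > 0, β₂ > 0, γ₁, γ₂ ∈ ℝ and t ∈ (0,1). Define γ̄ := t·γ₁ + (1−t)·γ₂ and β̄ := ( t/β₁ + (1−t)/β₂ + (2/α₀²)·t·(1−t)·(γ₁ − γ₂)² )⁻¹. Then: (a) β̄ > 0; (b) t·∫ ((β₁ − β̄)·x + (β̄·γ̄ − β₁·γ₁)) dμ_{(β₁,γ₁)}(x) + (1−t)·∫ ((β₂ − β̄)·x + (β̄·γ̄ − β₂·γ₂)) dμ_{(β₂,γ₂)}(x) = 0; and (c) t·∫ (γ̄ − x)·((β₁ − β̄)·x + (β̄·γ̄ − β₁·γ₁)) dμ_{(β₁,γ₁)}(x) + (1−t)·∫ (γ̄ − x)·((β₂ − β̄)·x + (β̄·γ̄ − β₂·γ₂)) dμ_{(β₂,γ₂)}(x) = 0. -/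
/-- The invariant measure of the Ornstein–Uhlenbeck process
`dX_t = −β(X_t − γ) dt + α₀ dW_t`: the Gaussian measure on `ℝ` with mean `γ` and
variance `α₀² / (2β)`. -/
noncomputable def ouInvariant (α₀ β γ : ℝ) : MeasureTheory.Measure ℝ :=
  ProbabilityTheory.gaussianReal γ (Real.toNNReal (α₀ ^ 2 / (2 * β)))

open MeasureTheory ProbabilityTheory in
lemma ou_quad (α₀ β γ : ℝ) (hβ : 0 < β) (a b c : ℝ) :
    ∫ x, (a * x ^ 2 + b * x + c) ∂(ouInvariant α₀ β γ)
      = a * (α₀ ^ 2 / (2 * β) + γ ^ 2) + b * γ + c := by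
  have hv : 0 ≤ α₀ ^ 2 / (2 * β) := by positivity
  unfold ouInvariant
  set v := Real.toNNReal (α₀ ^ 2 / (2 * β)) with hvdef
  have hvv : (v : ℝ) = α₀ ^ 2 / (2 * β) := Real.coe_toNNReal _ hv
  have hm : MemLp (id : ℝ → ℝ) 2 (gaussianReal γ v) :=
    memLp_id_gaussianReal' 2 (by simp)
  have h1 : Integrable (fun x : ℝ => x) (gaussianReal γ v) := hm.integrable (by norm_num)
  have h2 : Integrable (fun x : ℝ => x ^ 2) (gaussianReal γ v) := hm.integrable_sq
  have hvar := variance_eq_sub hm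
  rw [variance_id_gaussianReal] at hvar
  have e1 : ∫ x, x ∂(gaussianReal γ v) = γ := integral_id_gaussianReal
  have e2 : ∫ x, x ^ 2 ∂(gaussianReal γ v) = α₀ ^ 2 / (2 * β) + γ ^ 2 := by
    simp only [Pi.pow_apply, id_eq, e1, hvv] at hvar
    linarith
  have h3 : Integrable (fun x : ℝ => a * x ^ 2 + b * x) (gaussianReal γ v) :=
    (h2.const_mul a).add (h1.const_mul b)
  rw [integral_add h3 (integrable_const c),
    integral_add (h2.const_mul a) (h1.const_mul b), integral_const_mul, integral_const_mul,
    e1, e2]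
  simp

lemma ou_lin (α₀ β γ : ℝ) (hβ : 0 < β) (b c : ℝ) :
    ∫ x, (b * x + c) ∂(ouInvariant α₀ β γ) = b * γ + c := by
  simpa using ou_quad α₀ β γ hβ 0 b c

lemma ou_prod (α₀ β γ : ℝ) (hβ : 0 < β) (g B : ℝ) :
    ∫ x, (g - x) * ((β - B) * x + (B * g - β * γ)) ∂(ouInvariant α₀ β γ)
      = - (α₀ ^ 2 / 2) + B * (α₀ ^ 2 / (2 * β) + (g - γ) ^ 2) := by
  have h := ou_quad α₀ β γ hβ (-(β - B)) (g * (β - B) - (B * g - β * γ)) (g * (B * g - β * γ))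
  have e : ∀ x : ℝ, (g - x) * ((β - B) * x + (B * g - β * γ)) =
    (-(β - B)) * x ^ 2 + (g * (β - B) - (B * g - β * γ)) * x + g * (B * g - β * γ) := by
    intro x; ring
  simp_rw [e]
  rw [h]
  field_simp
  ring

/-- The pseudo-true parameter `(β̄, γ̄)` is a critical point of the weighted limit
criterion: `β̄ > 0` and the `γ`- and `β`-derivative equations vanish at `(β̄, γ̄)`. -/
theorem ou_pseudo_true_critical_point (α₀ : ℝ) (hα : α₀ ≠ 0)
    (β₁ β₂ : ℝ) (hβ₁ : 0 < β₁) (hβ₂ : 0 < β₂) (γ₁ γ₂ t : ℝ)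
    (ht0 : 0 < t) (ht1 : t < 1) :
    let γbar : ℝ := t * γ₁ + (1 - t) * γ₂
    let βbar : ℝ :=
      (t / β₁ + (1 - t) / β₂ + (2 / α₀ ^ 2) * t * (1 - t) * (γ₁ - γ₂) ^ 2)⁻¹
    0 < βbar ∧
    (t * ∫ x, ((β₁ - βbar) * x + (βbar * γbar - β₁ * γ₁)) ∂(ouInvariant α₀ β₁ γ₁)
      + (1 - t) *
        ∫ x, ((β₂ - βbar) * x + (βbar * γbar - β₂ * γ₂)) ∂(ouInvariant α₀ β₂ γ₂)
      = 0) ∧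
    (t * ∫ x, (γbar - x) * ((β₁ - βbar) * x + (βbar * γbar - β₁ * γ₁))
          ∂(ouInvariant α₀ β₁ γ₁)
      + (1 - t) *
        ∫ x, (γbar - x) * ((β₂ - βbar) * x + (βbar * γbar - β₂ * γ₂))
          ∂(ouInvariant α₀ β₂ γ₂)
      = 0) := by
  intro γbar βbar
  have h1t : 0 < 1 - t := by linarith
  have hS : 0 < t / β₁ + (1 - t) / β₂ + (2 / α₀ ^ 2) * t * (1 - t) * (γ₁ - γ₂) ^ 2 := by
    positivity
  have hB : βbar * (t / β₁ + (1 - t) / β₂ + (2 / α₀ ^ 2) * t * (1 - t) * (γ₁ - γ₂) ^ 2) = 1 :=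
    inv_mul_cancel₀ hS.ne'
  refine ⟨inv_pos.mpr hS, ?_, ?_⟩
  · rw [ou_lin _ _ _ hβ₁, ou_lin _ _ _ hβ₂]
    simp only [γbar]
    ring
  · rw [ou_prod _ _ _ hβ₁, ou_prod _ _ _ hβ₂]
    have key : t * (α₀ ^ 2 / (2 * β₁) + (γbar - γ₁) ^ 2)
        + (1 - t) * (α₀ ^ 2 / (2 * β₂) + (γbar - γ₂) ^ 2)
        = α₀ ^ 2 / 2 *
          (t / β₁ + (1 - t) / β₂ + (2 / α₀ ^ 2) * t * (1 - t) * (γ₁ - γ₂) ^ 2) := by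
      simp only [γbar]
      field_simp
      ring
    linear_combination βbar * key + α₀ ^ 2 / 2 * hB
end

section
/- Let α₀ ≠ 0 be real, β₁ > 0, β₂ > 0, γ₁, γ₂ ∈ ℝ and t ∈ (0,1). Define γ̄ := t·γ₁ + (1−t)·γ₂, β̄ := ( t/β₁ + (1−t)/β₂ + (2/α₀²)·t·(1−t)·(γ₁ − γ₂)² )⁻¹, and for β' > 0, γ' ∈ ℝ set G(β',γ') := (1/α₀) · ∫ ( (−β'·(x − γ')) − (−β̄·(x − γ̄)) ) dμ_{(β',γ')}(x). Then G(β₁,γ₁) − G(β₂,γ₂) = (β̄/α₀)·(γ₁ − γ₂). In particular, if γ₁ ≠ γ₂ then G(β₁,γ₁) ≠ G(β₂,γ₂), while if γ₁ = γ₂ (even when β₁ ≠ β₂) then G(β₁,γ₁) = G(β₂,γ₂). -/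
/-- Consistency condition [B4] for `T₁ₙᵝ` in the OU model:
`G(β₁,γ₁) − G(β₂,γ₂) = (β̄/α₀)(γ₁ − γ₂)`; hence `[B4]` holds iff `γ₁ ≠ γ₂`. -/
theorem ou_G_difference (α₀ : ℝ) (hα : α₀ ≠ 0)
    (β₁ β₂ : ℝ) (hβ₁ : 0 < β₁) (hβ₂ : 0 < β₂) (γ₁ γ₂ t : ℝ)
    (ht0 : 0 < t) (ht1 : t < 1) :
    let γbar : ℝ := t * γ₁ + (1 - t) * γ₂
    let βbar : ℝ :=
      (t / β₁ + (1 - t) / β₂ + (2 / α₀ ^ 2) * t * (1 - t) * (γ₁ - γ₂) ^ 2)⁻¹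
    let G : ℝ → ℝ → ℝ := fun β' γ' =>
      (1 / α₀) *
        ∫ x, ((-β' * (x - γ')) - (-βbar * (x - γbar))) ∂(ouInvariant α₀ β' γ')
    G β₁ γ₁ - G β₂ γ₂ = (βbar / α₀) * (γ₁ - γ₂) ∧
    (γ₁ ≠ γ₂ → G β₁ γ₁ ≠ G β₂ γ₂) ∧
    (γ₁ = γ₂ → G β₁ γ₁ = G β₂ γ₂) := by
  intro γbar βbar G
  have hb : 0 < βbar := by
    have h1 : 0 < 1 - t := by linarith
    have : 0 < α₀ ^ 2 := by positivity
    simp only [βbar]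
    positivity
  have hG : ∀ β' γ', G β' γ' = (1 / α₀) * (βbar * (γ' - γbar)) := by
    intro β' γ'
    simp only [G, ouInvariant]
    congr 1
    generalize Real.toNNReal (α₀ ^ 2 / (2 * β')) = v
    have hi : MeasureTheory.Integrable (fun x : ℝ => x)
        (ProbabilityTheory.gaussianReal γ' v) :=
      (ProbabilityTheory.memLp_id_gaussianReal (μ := γ') (v := v) 1).integrable le_rfl
    have he : (fun x : ℝ => (-β' * (x - γ')) - (-βbar * (x - γbar)))
        = fun x => (βbar - β') * x + (β' * γ' - βbar * γbar) := by
      funext x; ring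
    rw [he, MeasureTheory.integral_add (hi.const_mul _) (MeasureTheory.integrable_const _),
      MeasureTheory.integral_const_mul, ProbabilityTheory.integral_id_gaussianReal,
      MeasureTheory.integral_const]
    simp
    ring
  have hd : G β₁ γ₁ - G β₂ γ₂ = (βbar / α₀) * (γ₁ - γ₂) := by
    rw [hG, hG]; ring
  refine ⟨hd, fun hne heq => ?_, fun heq => ?_⟩
  · rw [heq, sub_self] at hd
    exact mul_ne_zero (div_ne_zero hb.ne' hα) (sub_ne_zero.mpr hne) hd.symm
  · rw [hG, hG, heq]
end

section
/- Let α₀ ≠ 0 be real, β₁ > 0, β₂ > 0, γ₁, γ₂ ∈ ℝ, and let β̄, γ̄ be arbitrary real numbers. For β' > 0, γ' ∈ ℝ define H(β',γ') ∈ ℝ² by H(β',γ')₁ := (1/α₀²) ∫ (−(x − γ̄))·( (−β'·(x − γ')) − (−β̄·(x − γ̄)) ) dμ_{(β',γ')}(x) and H(β',γ')₂ := (β̄/α₀²) ∫ ( (−β'·(x − γ')) − (−β̄·(x − γ̄)) ) dμ_{(β',γ')}(x). Then H(β₁,γ₁) − H(β₂,γ₂) = (β̄/α₀²) · ( −(α₀²/2)·(1/β₁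 − 1/β₂) − (γ₁ − γ₂)·(γ₁ + γ₂ − 2γ̄), β̄·(γ₁ − γ₂) ). -/
open MeasureTheory ProbabilityTheory in
lemma ou_quad_s13 (m : ℝ) (v : NNReal) (a b c : ℝ) :
    ∫ x, (a * x ^ 2 + b * x + c) ∂(gaussianReal m v) = a * (v + m ^ 2) + b * m + c := by
  have hL : MemLp (fun x : ℝ => x) 2 (gaussianReal m v) := memLp_id_gaussianReal' 2 (by simp)
  have h2 : Integrable (fun x : ℝ => x ^ 2) (gaussianReal m v) := hL.integrable_sq
  have h1 : Integrable (fun x : ℝ => x) (gaussianReal m v) := hL.integrable (by norm_num)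
  have hv : ∫ x, x ^ 2 ∂(gaussianReal m v) = v + m ^ 2 := by
    have h := variance_eq_sub hL
    rw [variance_fun_id_gaussianReal, integral_id_gaussianReal] at h
    simp only [Pi.pow_apply] at h
    linarith
  have h3 : Integrable (fun x : ℝ => a * x ^ 2 + b * x) (gaussianReal m v) :=
    (h2.const_mul a).add (h1.const_mul b)
  rw [integral_add h3 (integrable_const c),
    integral_add (h2.const_mul a) (h1.const_mul b), integral_const_mul, integral_const_mul,
    hv, integral_id_gaussianReal]
  simp

lemma ou_int1 (α₀ β γ p q : ℝ) (hβ : 0 < β) :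
    ∫ x, (-(x - q)) * ((-β * (x - γ)) - (-p * (x - q))) ∂(ouInvariant α₀ β γ)
      = α₀ ^ 2 / 2 - p * (α₀ ^ 2 / (2 * β) + (γ - q) ^ 2) := by
  have h := ou_quad_s13 γ (Real.toNNReal (α₀ ^ 2 / (2 * β))) (β - p)
    (-β * γ - β * q + 2 * p * q) (β * γ * q - p * q ^ 2)
  rw [Real.coe_toNNReal _ (by positivity)] at h
  unfold ouInvariant
  have e : (fun x : ℝ => (-(x - q)) * ((-β * (x - γ)) - (-p * (x - q)))) = fun x =>
      (β - p) * x ^ 2 + (-β * γ - β * q + 2 * p * q) * x + (β * γ * q - p * q ^ 2) := by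
    funext x; ring
  rw [e, h]
  field_simp
  ring

lemma ou_int2 (α₀ β γ p q : ℝ) :
    ∫ x, ((-β * (x - γ)) - (-p * (x - q))) ∂(ouInvariant α₀ β γ) = p * (γ - q) := by
  have h := ou_quad_s13 γ (Real.toNNReal (α₀ ^ 2 / (2 * β))) 0 (p - β) (β * γ - p * q)
  unfold ouInvariant
  have e : (fun x : ℝ => (-β * (x - γ)) - (-p * (x - q))) = fun x =>
      0 * x ^ 2 + (p - β) * x + (β * γ - p * q) := by
    funext x; ring
  rw [e, h]
  ring

/-- Difference formula for the vector `H` of the paper in the OU model: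
`H(β₁,γ₁) − H(β₂,γ₂)
  = (β̄/α₀²) • (−(α₀²/2)(1/β₁ − 1/β₂) − (γ₁ − γ₂)(γ₁ + γ₂ − 2γ̄), β̄(γ₁ − γ₂))`. -/
theorem ou_H_difference (α₀ : ℝ) (hα : α₀ ≠ 0)
    (β₁ β₂ : ℝ) (hβ₁ : 0 < β₁) (hβ₂ : 0 < β₂) (γ₁ γ₂ βbar γbar : ℝ) :
    let H : ℝ → ℝ → ℝ × ℝ := fun β' γ' =>
      ((1 / α₀ ^ 2) *
          ∫ x, (-(x - γbar)) * ((-β' * (x - γ')) - (-βbar * (x - γbar)))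
            ∂(ouInvariant α₀ β' γ'),
       (βbar / α₀ ^ 2) *
          ∫ x, ((-β' * (x - γ')) - (-βbar * (x - γbar))) ∂(ouInvariant α₀ β' γ'))
    H β₁ γ₁ - H β₂ γ₂ = (βbar / α₀ ^ 2) •
      (-(α₀ ^ 2 / 2) * (1 / β₁ - 1 / β₂) - (γ₁ - γ₂) * (γ₁ + γ₂ - 2 * γbar),
        βbar * (γ₁ - γ₂)) := by
  intro H
  simp only [H]
  rw [ou_int1 _ _ _ _ _ hβ₁, ou_int1 _ _ _ _ _ hβ₂, ou_int2, ou_int2]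
  ext
  · simp only [Prod.fst_sub, Prod.smul_fst, smul_eq_mul]
    field_simp
    ring
  · simp only [Prod.snd_sub, Prod.smul_snd, smul_eq_mul]
    ring
end

section
/- Let α₀ ≠ 0 be real, β₁ > 0, β₂ > 0, γ₁, γ₂ ∈ ℝ with (β₁,γ₁) ≠ (β₂,γ₂), and let t ∈ (0,1). Define γ̄ := t·γ₁ + (1−t)·γ₂ and β̄ := ( t/β₁ + (1−t)/β₂ + (2/α₀²)·t·(1−t)·(γ₁ − γ₂)² )⁻¹, and for β' > 0, γ' ∈ ℝ define H(β',γ') ∈ ℝ² by H(β',γ')₁ := (1/α₀²) ∫ (−(x − γ̄))·( (−β'·(x − γ')) − (−β̄·(x − γ̄)) ) dμ_{(β',γ')}(x) and H(β',γ')₂ := (β̄/α₀²) ∫ ( (−β'·(x − γ')) − (−β̄·(x − γ̄)) ) dμ_{(β',γ')}(x). Then H(β₁,γ₁) ≠ H(β₂,γ₂). -/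
open MeasureTheory ProbabilityTheory in
theorem quad_aux (m : ℝ) (v : NNReal) (a b c : ℝ) :
    ∫ x, (a + b * (x - m) + c * (x - m) ^ 2) ∂(gaussianReal m v) = a + c * v := by
  have h1 : Integrable (fun x : ℝ => x - m) (gaussianReal m v) := by
    have := (memLp_id_gaussianReal (μ := m) (v := v) 1).integrable (by simp)
    exact this.sub (integrable_const m)
  have h2 : Integrable (fun x : ℝ => (x - m) ^ 2) (gaussianReal m v) := by
    have := (memLp_id_gaussianReal (μ := m) (v := v) 2)
    exact (this.sub (memLp_const m)).integrable_sq
  have e1 : ∫ x, (x - m) ∂(gaussianReal m v) = 0 := by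
    have h3 : Integrable (fun x : ℝ => x) (gaussianReal m v) :=
      (memLp_id_gaussianReal (μ := m) (v := v) 1).integrable (by simp)
    rw [integral_sub h3 (integrable_const m), integral_id_gaussianReal]
    simp
  have e2 : ∫ x, (x - m) ^ 2 ∂(gaussianReal m v) = v := by
    have := variance_fun_id_gaussianReal (μ := m) (v := v)
    rw [variance_eq_integral (by fun_prop), integral_id_gaussianReal] at this
    exact this
  have h4 : Integrable (fun x : ℝ => a + b * (x - m)) (gaussianReal m v) :=
    (integrable_const a).add (h1.const_mul b)
  rw [integral_add h4 (h2.const_mul c),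
    integral_add (integrable_const a) (h1.const_mul b), integral_const_mul, integral_const_mul,
    e1, e2]
  simp

theorem ou_aux (α₀ β γ a b c : ℝ) (hβ : 0 < β) (f : ℝ → ℝ)
    (hf : ∀ x, f x = a + b * (x - γ) + c * (x - γ) ^ 2) :
    ∫ x, f x ∂(ouInvariant α₀ β γ) = a + c * (α₀ ^ 2 / (2 * β)) := by
  simp only [hf, ouInvariant]
  rw [quad_aux, Real.coe_toNNReal _ (by positivity)]

/-- Verification of the consistency condition [B5] for `T₂ₙᵝ` in the OU model:
for any drift-parameter change `(β₁,γ₁) ≠ (β₂,γ₂)`, the vectors `H(β₁,γ₁)` and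
`H(β₂,γ₂)` (with pseudo-true parameter `(β̄,γ̄)`) differ. -/
theorem ou_H_neq (α₀ : ℝ) (hα : α₀ ≠ 0)
    (β₁ β₂ : ℝ) (hβ₁ : 0 < β₁) (hβ₂ : 0 < β₂) (γ₁ γ₂ : ℝ)
    (hchange : (β₁, γ₁) ≠ (β₂, γ₂)) (t : ℝ) (ht0 : 0 < t) (ht1 : t < 1) :
    let γbar : ℝ := t * γ₁ + (1 - t) * γ₂
    let βbar : ℝ :=
      (t / β₁ + (1 - t) / β₂ + (2 / α₀ ^ 2) * t * (1 - t) * (γ₁ - γ₂) ^ 2)⁻¹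
    let H : ℝ → ℝ → ℝ × ℝ := fun β' γ' =>
      ((1 / α₀ ^ 2) *
          ∫ x, (-(x - γbar)) * ((-β' * (x - γ')) - (-βbar * (x - γbar)))
            ∂(ouInvariant α₀ β' γ'),
       (βbar / α₀ ^ 2) *
          ∫ x, ((-β' * (x - γ')) - (-βbar * (x - γbar))) ∂(ouInvariant α₀ β' γ'))
    H β₁ γ₁ ≠ H β₂ γ₂ := by
  intro γbar βbar H heq
  have hs : 0 < 1 - t := by linarith
  have hB : 0 < βbar := by
    simp only [βbar]
    positivity
  have hg : γbar = t * γ₁ + (1 - t) * γ₂ := rfl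
  have ha : 0 < α₀ ^ 2 := by positivity
  clear_value βbar γbar
  have hH : ∀ β γ, 0 < β → H β γ = ((1 / α₀ ^ 2) *
      (-βbar * (γ - γbar) ^ 2 + (β - βbar) * (α₀ ^ 2 / (2 * β))),
      (βbar / α₀ ^ 2) * (βbar * (γ - γbar) + 0 * (α₀ ^ 2 / (2 * β)))) := by
    intro β γ hβ
    simp only [H]
    rw [ou_aux α₀ β γ (-βbar * (γ - γbar) ^ 2) ((β - 2 * βbar) * (γ - γbar)) (β - βbar) hβ _
      (fun x => by ring),
      ou_aux α₀ β γ (βbar * (γ - γbar)) (βbar - β) 0 hβ _ (fun x => by ring)]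
  rw [hH _ _ hβ₁, hH _ _ hβ₂, Prod.mk.injEq] at heq
  obtain ⟨e1, e2⟩ := heq
  have hγ : γ₁ = γ₂ := by
    have := mul_left_cancel₀ (by positivity) e2
    simp only [zero_mul, add_zero] at this
    have := mul_left_cancel₀ hB.ne' this
    linarith
  subst hγ
  have e3 := mul_left_cancel₀ (by positivity) e1
  have e4 := add_left_cancel e3
  field_simp at e4
  apply hchange
  have : βbar * (β₁ - β₂) = 0 := by linarith
  have := (mul_eq_zero.mp this).resolve_left hB.ne'
  rw [sub_eq_zero.mp this]
end
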